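/- arXiv:2212.14317 — 6 statements merged into one kernel-verified Lean document; each statement's English description precedes it below -/
import Mathlib

section
/- Let E be a type (the set of indices of a correlation plan), let J be a nonempty type, let S₀ : Set E and S : J → Set E be such that the sets S j are pairwise disjoint and each S j is disjoint from S₀, and E = S₀ ∪ ⋃ j, S j. Let (C i)_{i : ι} be a family of predicates on functions E → ℝ (the constraints), and suppose each constraint i has a support supp i : Set E, meaning that for all f, g : E → ℝ, if f and g agree on supp i then C i f holds if and only if C i g holds; suppose moreover that for every i there exists j with supp i ⊆ S₀ ∪ S j. Let ξ₀ : E → ℝ and let ξ : J → (E → ℝ) be such that for every j, ξ j agrees with ξ₀ on S₀, and ξ j satisfies every constraint C i whose support satisfies supp i ⊆ S₀ ∪ S j. Define the glued function ξ̃ : E → ℝ by ξ̃ e = ξ j e whenever e ∈ S j, and ξ̃ e = ξ₀ e whenever e belongs to no S j. Then ξ̃ satisfies every constraint C i. -/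
/-- Gluing per-subgame refinements into a complete refinement.  The index set
`E` of the correlation plan is covered by a pre-subgame part `S₀` and
pairwise disjoint subgame parts `S j`; every constraint `C i` depends only on
its support `supp i`, which is contained in `S₀ ∪ S j` for some `j`.  If each
per-subgame refinement `ξ j` agrees with the blueprint `ξ₀` on `S₀` and
satisfies every constraint supported on `S₀ ∪ S j`, then the glued function
`ξt` (equal to `ξ j` on `S j` and to `ξ₀` off all the `S j`) satisfies every
constraint. -/
theorem glued_refinement_satisfies_constraints
    {E : Type*} {J : Type*} [Nonempty J] {ι : Type*}
    (S₀ : Set E) (S : J → Set E)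
    (hSdisj : ∀ j k, j ≠ k → Disjoint (S j) (S k))
    (hS₀disj : ∀ j, Disjoint (S j) S₀)
    (hcover : (Set.univ : Set E) = S₀ ∪ ⋃ j, S j)
    (C : ι → (E → ℝ) → Prop) (supp : ι → Set E)
    (hsupp : ∀ i (f g : E → ℝ), (∀ e ∈ supp i, f e = g e) → (C i f ↔ C i g))
    (hloc : ∀ i, ∃ j, supp i ⊆ S₀ ∪ S j)
    (ξ₀ : E → ℝ) (ξ : J → E → ℝ)
    (hagree : ∀ j, ∀ e ∈ S₀, ξ j e = ξ₀ e)
    (hsat : ∀ j i, supp i ⊆ S₀ ∪ S j → C i (ξ j))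
    (ξt : E → ℝ)
    (hglue₁ : ∀ j, ∀ e ∈ S j, ξt e = ξ j e)
    (hglue₂ : ∀ e, (∀ j, e ∉ S j) → ξt e = ξ₀ e) :
    ∀ i, C i ξt := by
  intro i
  obtain ⟨j, hj⟩ := hloc i
  refine (hsupp i ξt (ξ j) fun e he => ?_).mpr (hsat j i hj)
  rcases hj he with h₀ | hS
  · rw [hagree j e h₀]
    exact hglue₂ e fun k hk => Set.disjoint_left.mp (hS₀disj k) hk h₀
  · exact hglue₁ j e hS
end

section
/- Let V be a finite type and ≺ a binary relation on V (u ≺ v meaning u is a child of v) whose transitive closure is irreflexive. Let F ⊆ V be a set of head nodes, and let μ, μ₀, μ̆, c : V → ℝ be functions such that for every v ∉ F: the set ch v = {u | u ≺ v} is nonempty, μ v = c v + ∑_{u ∈ ch v} μ u, μ₀ v = c v + ∑_{u ∈ ch v} μ₀ u, and for every u ∈ ch v, μ̆ u = μ₀ u − (μ₀ v − μ̆ v)/|ch v|. If μ h ≥ μ̆ h for every h ∈ F, then μ v ≥ μ̆ v for every v ∈ V. -/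
/-- Abstract lower-bound half of Theorem 2: values `μ` (refined) and `μ₀`
(blueprint) satisfy the same recursive equations down the tree outside the
set `F` of head nodes, the bounds `μ̆` (here `μlb`) are propagated by
splitting the slack equally among children, and the bounds are enforced at
the head nodes.  Then the lower bound holds at every node. -/
theorem lower_bounds_propagate {V : Type*} [Fintype V]
    (prec : V → V → Prop) [DecidableRel prec]
    (hirr : ∀ v : V, ¬ Relation.TransGen prec v v)
    (F : Set V) (μ μ₀ μlb c : V → ℝ)
    (hne : ∀ v ∉ F, (Finset.univ.filter (fun u => prec u v)).Nonempty)
    (hμ : ∀ v ∉ F, μ v = c v + ∑ u ∈ Finset.univ.filter (fun u => prec u v), μ u)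
    (hμ₀ : ∀ v ∉ F, μ₀ v = c v + ∑ u ∈ Finset.univ.filter (fun u => prec u v), μ₀ u)
    (hlb : ∀ v ∉ F, ∀ u ∈ Finset.univ.filter (fun u => prec u v),
      μlb u = μ₀ u - (μ₀ v - μlb v) / (Finset.univ.filter (fun u => prec u v)).card)
    (hhead : ∀ h ∈ F, μ h ≥ μlb h) :
    ∀ v : V, μ v ≥ μlb v := by
  have : Std.Irrefl (Relation.TransGen prec) := ⟨hirr⟩
  have hwf : WellFounded (Relation.TransGen prec) :=
    Finite.wellFounded_of_trans_of_irrefl _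
  intro v
  induction v using hwf.induction with
  | _ v ih =>
    by_cases hv : v ∈ F
    · exact hhead v hv
    have hcard : ((Finset.univ.filter (fun u => prec u v)).card : ℝ) ≠ 0 :=
      Nat.cast_ne_zero.mpr (hne v hv).card_pos.ne'
    have hle : ∑ u ∈ Finset.univ.filter (fun u => prec u v), μlb u ≤
        ∑ u ∈ Finset.univ.filter (fun u => prec u v), μ u :=
      Finset.sum_le_sum fun u hu => ih u (.single (Finset.mem_filter.mp hu).2)
    rw [Finset.sum_congr rfl (hlb v hv), Finset.sum_sub_distrib, Finset.sum_const,
      nsmul_eq_mul, mul_div_cancel₀ _ hcard] at hle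
    linarith [hμ v hv, hμ₀ v hv]
end

section
/- Let V be a finite type and ≺ a binary relation on V (u ≺ v meaning u is a child of v) whose transitive closure is irreflexive. Let F ⊆ V be a set of head nodes, and let β, β₀, β̆, c : V → ℝ be functions such that for every v ∉ F there is a nonempty finite family G v of nonempty finite subsets of {u | u ≺ v} with: β v = c v + ∑_{I ∈ G v} max_{u ∈ I} β u, β₀ v = c v + ∑_{I ∈ G v} max_{u ∈ I} β₀ u, and for every I ∈ G v and every u ∈ I, β̆ u = max_{u' ∈ I} β₀ u' + (β̆ v − β₀ v)/|G v|. If β h ≤ β̆ h for every h ∈ F, then β v ≤ β̆ v for every v ∈ V. -/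
/-- Abstract upper-bound half of Theorem 2: values `β` (refined) and `β₀`
(blueprint) of sequences under a best-deviating response satisfy the same
recursive equations down the tree outside the set `F` of head nodes, where
`G v` is the family of infosets (sets of children actions) following `v` and
the infoset value is the max of `β` over its members; the bounds `β̆` (here
`βub`) are propagated by splitting the slack equally among the infosets, and
are enforced at the head nodes.  Then the upper bound holds at every node. -/
theorem upper_bounds_propagate {V : Type*} [Fintype V]
    (prec : V → V → Prop)
    (hirr : ∀ v : V, ¬ Relation.TransGen prec v v)
    (F : Set V) (β β₀ βub c : V → ℝ)
    (G : V → Finset (Finset V))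
    (hGne : ∀ v ∉ F, (G v).Nonempty)
    (hne : ∀ v, ∀ hv : v ∉ F, ∀ I ∈ G v, I.Nonempty)
    (hch : ∀ v ∉ F, ∀ I ∈ G v, ∀ u ∈ I, prec u v)
    (hβ : ∀ v, ∀ hv : v ∉ F,
      β v = c v + ∑ I ∈ (G v).attach, I.1.sup' (hne v hv I.1 I.2) β)
    (hβ₀ : ∀ v, ∀ hv : v ∉ F,
      β₀ v = c v + ∑ I ∈ (G v).attach, I.1.sup' (hne v hv I.1 I.2) β₀)
    (hub : ∀ v, ∀ hv : v ∉ F, ∀ (I : Finset V) (hI : I ∈ G v), ∀ u ∈ I,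
      βub u = I.sup' (hne v hv I hI) β₀ + (βub v - β₀ v) / (G v).card)
    (hhead : ∀ h ∈ F, β h ≤ βub h) :
    ∀ v : V, β v ≤ βub v := by
  have : Std.Irrefl (Relation.TransGen prec) := ⟨hirr⟩
  have hwf : WellFounded (Relation.TransGen prec) := Finite.wellFounded_of_trans_of_irrefl _
  intro v
  induction v using hwf.induction with
  | h v ih =>
    by_cases hv : v ∈ F
    · exact hhead v hv
    have hcard : ((G v).card : ℝ) ≠ 0 :=
      Nat.cast_ne_zero.mpr (Finset.card_ne_zero.mpr (hGne v hv))
    have hsum : ∑ I ∈ (G v).attach, I.1.sup' (hne v hv I.1 I.2) β ≤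
        ∑ I ∈ (G v).attach,
          (I.1.sup' (hne v hv I.1 I.2) β₀ + (βub v - β₀ v) / (G v).card) := by
      refine Finset.sum_le_sum fun I _ => Finset.sup'_le _ _ fun u hu => ?_
      rw [← hub v hv I.1 I.2 u hu]
      exact ih u (.single (hch v hv I.1 I.2 u hu))
    rw [Finset.sum_add_distrib, Finset.sum_const, Finset.card_attach, nsmul_eq_mul,
      mul_div_cancel₀ _ hcard] at hsum
    linarith [hβ v hv, hβ₀ v hv]
end

section
/- Let V be a finite type and ≺ a binary relation on V (u ≺ v meaning u is a child of v) whose transitive closure is irreflexive. Let F ⊆ V be a set of head nodes, and let μ₀, μ̆, c : V → ℝ be functions such that for every v ∉ F: the set ch v = {u | u ≺ v} is nonempty, μ₀ v = c v + ∑_{u ∈ ch v} μ₀ u, and for every u ∈ ch v, μ̆ u = μ₀ u − (μ₀ v − μ̆ v)/|ch v|. Let r ∈ V satisfy μ̆ r ≤ μ₀ r. Then for every node v reachable from r by a finite chain r = v₀, v₁, …, v_n = v with v_{k+1} ≺ v_k for all k and v_k ∉ F for all k < n, we have μ̆ v ≤ μ₀ v. -/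
/-- Feasibility of the refinement LP: the blueprint satisfies all derived
lower-bound constraints.  Bounds `μ̆` (here `μlb`) are propagated down the
tree from a root trigger `r` by equal slack-splitting among children; if the
initial bound satisfies `μlb r ≤ μ₀ r`, then `μlb v ≤ μ₀ v` at every node `v`
reachable from `r` by a chain of child steps staying outside the head set `F`
until the last node. -/
theorem blueprint_feasible {V : Type*} [Fintype V]
    (prec : V → V → Prop) [DecidableRel prec]
    (hirr : ∀ v : V, ¬ Relation.TransGen prec v v)
    (F : Set V) (μ₀ μlb c : V → ℝ)
    (hne : ∀ v ∉ F, (Finset.univ.filter (fun u => prec u v)).Nonempty)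
    (hμ₀ : ∀ v ∉ F, μ₀ v = c v + ∑ u ∈ Finset.univ.filter (fun u => prec u v), μ₀ u)
    (hlb : ∀ v ∉ F, ∀ u ∈ Finset.univ.filter (fun u => prec u v),
      μlb u = μ₀ u - (μ₀ v - μlb v) / (Finset.univ.filter (fun u => prec u v)).card)
    (r : V) (hr : μlb r ≤ μ₀ r) :
    ∀ v : V, Relation.ReflTransGen (fun x y => prec y x ∧ x ∉ F) r v →
      μlb v ≤ μ₀ v := by
  intro v h
  induction h with
  | refl => exact hr
  | @tail x u _ hstep ih =>
    rw [hlb x hstep.2 u (Finset.mem_filter.mpr ⟨Finset.mem_univ u, hstep.1⟩)]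
    exact sub_le_self _ (div_nonneg (sub_nonneg.mpr ih) (Nat.cast_nonneg _))
end

section
/- Let V be a finite meet-semilattice in which, for every v ∈ V, the set {u | u ≤ v} is a chain (a tree order). Let pl : V → Fin 2 assign each node to one of two players (the game has no chance nodes), and let ∼ be an equivalence relation on V (nodes in the same information set) such that equivalent nodes belong to the same player. Assume the following perfect-recall property: for every node w, all covers c, c' of w with c ≠ c', and all nodes s ≥ c and s' ≥ c' with pl s = pl w and pl s' = pl w, we have ¬(s ∼ s'). Then for all nodes h₁, h₁' with h₁ ∼ h₁', and all nodes h₂ ≤ h₁ and h₂' ≤ h₁', if w = h₂ ⊓ h₂' satisfies w < h₂ and w < h₂', then pl w ≠ pl h₁. -/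
/-- Player-elimination step of the appendix theorem on critical infosets:
in a finite tree order (a meet-semilattice whose principal lower sets are
chains) without chance nodes, with a player assignment `pl` and an
information-set equivalence `sim` respecting players and satisfying perfect
recall, if `h₁ ∼ h₁'` and `h₂ ≤ h₁`, `h₂' ≤ h₁'` have lowest common ancestor
`w = h₂ ⊓ h₂'` strictly below both, then `w` cannot belong to the player of
`h₁`. -/
theorem lca_player_ne {V : Type*} [Fintype V] [SemilatticeInf V]
    (hchain : ∀ v : V, IsChain (· ≤ ·) {u | u ≤ v})
    (pl : V → Fin 2)
    (sim : V → V → Prop) (hsim : Equivalence sim)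
    (hpl : ∀ x y, sim x y → pl x = pl y)
    (hpr : ∀ w c c' : V, w ⋖ c → w ⋖ c' → c ≠ c' →
      ∀ s s' : V, c ≤ s → c' ≤ s' → pl s = pl w → pl s' = pl w → ¬ sim s s')
    (h₁ h₁' h₂ h₂' : V) (h : sim h₁ h₁')
    (hle : h₂ ≤ h₁) (hle' : h₂' ≤ h₁')
    (hlt : h₂ ⊓ h₂' < h₂) (hlt' : h₂ ⊓ h₂' < h₂') :
    pl (h₂ ⊓ h₂') ≠ pl h₁ := by
  intro hw
  obtain ⟨c, hc, hc₂⟩ := exists_covBy_le_of_lt hlt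
  obtain ⟨c', hc', hc₂'⟩ := exists_covBy_le_of_lt hlt'
  refine hpr _ c c' hc hc' ?_ h₁ h₁' (hc₂.trans hle) (hc₂'.trans hle') hw.symm
    ((hpl _ _ h).symm.trans hw.symm) h
  rintro rfl
  exact hc.lt.not_ge (le_inf hc₂ hc₂')
end

section
/- Let E and F be real vector spaces, let X ⊆ E be a convex set, let Y ⊆ F be a nonempty convex set, and let h : E → ℝ be an affine map with h x ≥ 0 for all x ∈ X. Then the scaled extension X ◁_h Y = {(x, y) : x ∈ X and y ∈ h(x) • Y} = {(x, y) : x ∈ X and ∃ y' ∈ Y, y = h(x) • y'} is a convex subset of E × F. -/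
open scoped Pointwise in
/-- A sum of nonnegative multiples of two points of a convex set is a multiple of a single point. -/
theorem Convex.exists_smul_add_smul_eq {F : Type*} [AddCommGroup F] [Module ℝ F] {Y : Set F}
    (hY : Convex ℝ Y) {s t : ℝ} (hs : 0 ≤ s) (ht : 0 ≤ t) {u v : F} (hu : u ∈ Y) (hv : v ∈ Y) :
    ∃ w ∈ Y, s • u + t • v = (s + t) • w := by
  have hmem : s • u + t • v ∈ (s + t) • Y := by
    rw [hY.add_smul hs ht]
    exact Set.add_mem_add (Set.smul_mem_smul_set hu) (Set.smul_mem_smul_set hv)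
  obtain ⟨w, hw, hw_eq⟩ := hmem
  exact ⟨w, hw, hw_eq.symm⟩

/-- The scaled extension `X ◁_h Y = {(x, y) : x ∈ X, y ∈ h(x) • Y}` of a
convex set `X` with a nonempty convex set `Y` via an affine map `h` that is
nonnegative on `X` is convex. -/
theorem scaledExtension_convex {E F : Type*}
    [AddCommGroup E] [Module ℝ E] [AddCommGroup F] [Module ℝ F]
    (X : Set E) (hX : Convex ℝ X)
    (Y : Set F) (hYne : Y.Nonempty) (hY : Convex ℝ Y)
    (h : E →ᵃ[ℝ] ℝ) (hpos : ∀ x ∈ X, 0 ≤ h x) :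
    Convex ℝ {p : E × F | p.1 ∈ X ∧ ∃ y' ∈ Y, p.2 = h p.1 • y'} := by
  rintro ⟨x₁, y₁⟩ ⟨hx₁, u, hu, hy₁⟩ ⟨x₂, y₂⟩ ⟨hx₂, v, hv, hy₂⟩ a b ha hb hab
  dsimp only at hx₁ hx₂ hy₁ hy₂
  subst hy₁ hy₂
  obtain ⟨w, hw, hw_eq⟩ := hY.exists_smul_add_smul_eq
    (mul_nonneg ha (hpos x₁ hx₁)) (mul_nonneg hb (hpos x₂ hx₂)) hu hv
  refine ⟨hX hx₁ hx₂ ha hb hab, w, hw, ?_⟩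
  have h_comb : h (a • x₁ + b • x₂) = a * h x₁ + b * h x₂ := by
    simpa using Convex.combo_affine_apply (f := h) hab
  simpa [h_comb, smul_smul] using hw_eq
end
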